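/- arXiv:2502.01289 — 3 statements merged into one kernel-verified Lean document; each statement's English description precedes it below -/
import Mathlib

section
/- For every real number x with 0 < x < 2, the partial products ∏_{i=0}^{d} (1 + (1−x)^(2^i)) converge to 1/x as d → ∞. -/
open Filter Topology

theorem one_sub_mul_prod_one_add_pow_two_pow {R : Type*} [CommRing R] (y : R) (n : ℕ) :
    (1 - y) * ∏ i ∈ Finset.range n, (1 + y ^ (2 ^ i)) = 1 - y ^ (2 ^ n) := by
  induction n with
  | zero => simp
  | succ n ih => rw [Finset.prod_range_succ, ← mul_assoc, ih, pow_succ 2 n, pow_mul]; ring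

theorem goldschmidt_tendsto_inv (x : ℝ) (hx0 : 0 < x) (hx2 : x < 2) :
    Tendsto (fun d : ℕ => ∏ i ∈ Finset.range (d + 1), (1 + (1 - x) ^ (2 ^ i)))
      atTop (𝓝 (1 / x)) := by
  have hprod (d : ℕ) : ∏ i ∈ Finset.range (d + 1), (1 + (1 - x) ^ (2 ^ i)) =
      (1 - (1 - x) ^ (2 ^ (d + 1))) / x := by
    rw [eq_div_iff hx0.ne', mul_comm, ← one_sub_mul_prod_one_add_pow_two_pow, sub_sub_cancel]
  have habs : |1 - x| < 1 := abs_lt.2 ⟨by linarith, by linarith⟩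
  have hexp : Tendsto (fun d : ℕ => 2 ^ (d + 1)) atTop (atTop : Filter ℕ) :=
    (tendsto_pow_atTop_atTop_of_one_lt one_lt_two).comp (tendsto_add_atTop_nat 1)
  simpa [hprod] using
    (((tendsto_pow_atTop_nhds_zero_of_abs_lt_one habs).comp hexp).const_sub 1).div_const x
end

section
/- Fix a real number x with 0 < x < 2 and define sequences a, b : ℕ → ℝ by b₀ = 1 − x, b_{n+1} = b_n², a₀ = 2 − x, and a_{n+1} = a_n · (1 + b_{n+1}). Then for every natural number d: (i) b_d = (1−x)^(2^d); (ii) a_d = ∏_{i=0}^{d} (1 + (1−x)^(2^i)); and (iii) a_d = (1 − (1−x)^(2^(d+1))) / x. In particular 1/x − a_d = (1−x)^(2^(d+1))/x, so a_d approximates 1/x. -/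
theorem goldschmidt_algorithm_correct (x : ℝ) (hx0 : 0 < x) (hx2 : x < 2)
    (a b : ℕ → ℝ)
    (hb0 : b 0 = 1 - x) (hb : ∀ n : ℕ, b (n + 1) = (b n) ^ 2)
    (ha0 : a 0 = 2 - x) (ha : ∀ n : ℕ, a (n + 1) = a n * (1 + b (n + 1))) :
    ∀ d : ℕ,
      b d = (1 - x) ^ (2 ^ d) ∧
      a d = ∏ i ∈ Finset.range (d + 1), (1 + (1 - x) ^ (2 ^ i)) ∧
      a d = (1 - (1 - x) ^ (2 ^ (d + 1))) / x ∧
      1 / x - a d = (1 - x) ^ (2 ^ (d + 1)) / x := by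
  have hb_eq : ∀ d : ℕ, b d = (1 - x) ^ (2 ^ d) := by
    intro d
    induction d with
    | zero => simp [hb0]
    | succ n ih => rw [hb, ih, ← pow_mul, ← pow_succ]
  have ha_prod : ∀ d : ℕ, a d = ∏ i ∈ Finset.range (d + 1), (1 + (1 - x) ^ (2 ^ i)) := by
    intro d
    induction d with
    | zero =>
      rw [ha0, zero_add, Finset.prod_range_one]
      ring
    | succ n ih => rw [ha, hb_eq, ih, Finset.prod_range_succ _ (n + 1)]
  have ha_mul : ∀ d : ℕ, a d * x = 1 - (1 - x) ^ (2 ^ (d + 1)) := by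
    intro d
    induction d with
    | zero =>
      rw [ha0]
      ring
    | succ n ih =>
      rw [ha, hb_eq, mul_right_comm, ih, pow_succ 2 (n + 1), pow_mul]
      ring
  intro d
  have ha_div : a d = (1 - (1 - x) ^ (2 ^ (d + 1))) / x :=
    eq_div_of_mul_eq hx0.ne' (ha_mul d)
  refine ⟨hb_eq d, ha_prod d, ha_div, ?_⟩
  rw [ha_div, ← sub_div, sub_sub_cancel]
end

section
/- Let d, n, L be positive natural numbers. For each ℓ ∈ {1, …, L}, let g_ℓ : (Fin d → ℝ) → (Fin d → ℝ) and let G_ℓ be the map on d×n real matrices applying g_ℓ to each column. Let B_1, …, B_L and H_0 be d×n real matrices, and define the (unpermuted) adapter outputs by H_ℓ = G_ℓ(B_ℓ + H_{ℓ−1}) + H_{ℓ−1} for ℓ = 1, …, L. Let σ_1, …, σ_{L+1} be permutations of Fin n, and define the client-side (permuted) computation by K_0 = H_0 with columns permuted by σ_1, and for ℓ = 1, …, L, K_ℓ = [G_ℓ((B_ℓ with columns permuted by σ_ℓ) + K_{ℓ−1}) + K_{ℓ−1}] with columns re-permuted by σ_ℓ⁻¹ ∘ σ_{ℓ+1}.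 Then for every ℓ ∈ {0, 1, …, L}, K_ℓ equals H_ℓ with columns permuted by σ_{ℓ+1}. In particular, the client can compute correctly permuted adapter outputs while only ever observing column-permuted versions of the intermediate representations B_ℓ and only the relabeling permutations σ_ℓ⁻¹ ∘ σ_{ℓ+1}. -/
theorem permuted_adapter_computation_correct
    {d n L : ℕ} (hd : 0 < d) (hn : 0 < n) (hL : 0 < L)
    (g : ℕ → (Fin d → ℝ) → (Fin d → ℝ))
    (G : ℕ → Matrix (Fin d) (Fin n) ℝ → Matrix (Fin d) (Fin n) ℝ)
    (hG : ∀ (ℓ : ℕ) (M : Matrix (Fin d) (Fin n) ℝ) (i : Fin d) (j : Fin n),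
      G ℓ M i j = g ℓ (fun i' => M i' j) i)
    (B H K : ℕ → Matrix (Fin d) (Fin n) ℝ)
    (σ : ℕ → Equiv.Perm (Fin n))
    -- unpermuted adapter recurrence: H_ℓ = G_ℓ(B_ℓ + H_{ℓ-1}) + H_{ℓ-1}
    (hH : ∀ ℓ : ℕ, 1 ≤ ℓ → ℓ ≤ L →
      H ℓ = G ℓ (B ℓ + H (ℓ - 1)) + H (ℓ - 1))
    -- client-side computation on permuted data
    (hK0 : K 0 = Matrix.of fun i j => H 0 i (σ 1 j))
    (hK : ∀ ℓ : ℕ, 1 ≤ ℓ → ℓ ≤ L →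
      K ℓ = Matrix.of fun i j =>
        (G ℓ ((Matrix.of fun i' j' => B ℓ i' (σ ℓ j')) + K (ℓ - 1)) + K (ℓ - 1))
          i ((σ ℓ)⁻¹ (σ (ℓ + 1) j))) :
    ∀ ℓ : ℕ, ℓ ≤ L → K ℓ = Matrix.of fun i j => H ℓ i (σ (ℓ + 1) j) := by
  intro ℓ
  induction ℓ with
  | zero => exact fun _ => hK0
  | succ k ih =>
    intro hk
    rw [hK (k + 1) (by omega) hk, hH (k + 1) (by omega) hk]
    simp only [Nat.add_sub_cancel]
    rw [ih (by omega)]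
    ext i j
    simp [hG]
end
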